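/- Let p ≠ 2 be a prime and let e = ν_p(F(p−ε)). Let N(p) be the number of distinct residues F(i) mod p^e as i ranges over the Lucas non-zeros in {0, 1, …, π(p)−1}, and let Z(p) be the number of Lucas zeros i ∈ {0, 1, …, π(p)−1} such that F(i) ≢ F(j) (mod p^e) for every Lucas non-zero j ∈ {0, 1, …, π(p)−1}. Then the sequence λ ↦ |{F(n) mod p^λ : n ≥ 0}| / p^λ converges, as λ → ∞, to N(p)/p^e + Z(p)/(2 p^{2e−1} (p+1)). -/

import Mathlib

/-- The Lucas sequence: `L 0 = 2`, `L 1 = 1`, `L (n+2) = L (n+1) + L n`. -/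
def lucas : ℕ → ℕ
  | 0 => 2
  | 1 => 1
  | n + 2 => lucas (n + 1) + lucas n

/-- The Pisano period of the Fibonacci sequence modulo `p`: the least `m ≥ 1`
with `F (n + m) ≡ F n (mod p)` for all `n`. -/
noncomputable def pisano (p : ℕ) : ℕ :=
  sInf {m | 1 ≤ m ∧ ∀ n, Nat.fib (n + m) ≡ Nat.fib n [MOD p]}

/-- The natural number `p - ε`, where `ε = 1` if `p ≡ 1, 4 (mod 5)`,
`ε = -1` if `p ≡ 2, 3 (mod 5)`, and `ε = 0` if `5 ∣ p`. -/
def pSubEps (p : ℕ) : ℕ :=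
  if p % 5 = 1 ∨ p % 5 = 4 then p - 1
  else if p % 5 = 2 ∨ p % 5 = 3 then p + 1
  else p

/-- The Wall exponent `e = ν_p (F (p - ε))`. -/
def wallExp (p : ℕ) : ℕ := padicValNat p (Nat.fib (pSubEps p))

/-- `N(p)`: the number of distinct residues `F i mod p^e` for Lucas non-zeros
`i ∈ {0, …, π(p) - 1}`. -/
noncomputable def Nres (p : ℕ) : ℕ :=
  (((Finset.range (pisano p)).filter fun i => ¬ p ∣ lucas i).image
    fun i => (Nat.fib i : ZMod (p ^ wallExp p))).card

/-- `Z(p)`: the number of Lucas zeros `i ∈ {0, …, π(p) - 1}` with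
`F i ≢ F j (mod p^e)` for every Lucas non-zero `j ∈ {0, …, π(p) - 1}`. -/
noncomputable def Zres (p : ℕ) : ℕ :=
  ((Finset.range (pisano p)).filter fun i => p ∣ lucas i ∧
    ∀ j ∈ (Finset.range (pisano p)).filter (fun j => ¬ p ∣ lucas j),
      (Nat.fib i : ZMod (p ^ wallExp p)) ≠ (Nat.fib j : ZMod (p ^ wallExp p))).card

theorem two_mul_fib_succ (n : ℕ) : 2 * (Nat.fib (n + 1) : ℤ) = Nat.fib n + lucas n := by
  induction n using Nat.twoStepInduction with
  | zero => simp [lucas]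
  | one => simp [lucas]
  | more n h1 h2 =>
    have h : (Nat.fib (n + 2 + 1) : ℤ) = Nat.fib (n + 1) + Nat.fib (n + 2) := by
      exact_mod_cast Nat.fib_add_two
    have h' : (Nat.fib (n + 2) : ℤ) = Nat.fib n + Nat.fib (n + 1) := by
      exact_mod_cast Nat.fib_add_two
    have hl : (lucas (n + 2) : ℤ) = lucas (n + 1) + lucas n := by
      exact_mod_cast (by rw [lucas] : lucas (n + 2) = lucas (n + 1) + lucas n)
    have h2' : 2 * (Nat.fib (n + 2) : ℤ) = Nat.fib (n + 1) + lucas (n + 1) := h2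
    linarith

theorem two_mul_lucas_succ (n : ℕ) : 2 * (lucas (n + 1) : ℤ) = lucas n + 5 * Nat.fib n := by
  have h1 := two_mul_fib_succ n
  have h2 := two_mul_fib_succ (n + 1)
  have h : (Nat.fib (n + 1 + 1) : ℤ) = Nat.fib n + Nat.fib (n + 1) := by
    exact_mod_cast Nat.fib_add_two
  linarith

theorem fib_lucas_add (m n : ℕ) :
    2 * (Nat.fib (m + n) : ℤ) = Nat.fib m * lucas n + lucas m * Nat.fib n ∧
      2 * (lucas (m + n) : ℤ) = lucas m * lucas n + 5 * (Nat.fib m * Nat.fib n) := by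
  induction n with
  | zero => simp [lucas, mul_comm]
  | succ n ih =>
    have h1 := two_mul_fib_succ (m + n)
    have h2 := two_mul_lucas_succ (m + n)
    have h3 := two_mul_fib_succ n
    have h4 := two_mul_lucas_succ n
    rw [← add_assoc]
    constructor <;> refine mul_left_cancel₀ (two_ne_zero (α := ℤ)) ?_ <;> grind

theorem two_mul_fib_add (m n : ℕ) :
    2 * (Nat.fib (m + n) : ℤ) = Nat.fib m * lucas n + lucas m * Nat.fib n :=
  (fib_lucas_add m n).1

theorem two_mul_lucas_add (m n : ℕ) :
    2 * (lucas (m + n) : ℤ) = lucas m * lucas n + 5 * (Nat.fib m * Nat.fib n) :=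
  (fib_lucas_add m n).2

theorem fib_two_mul_eq (n : ℕ) : (Nat.fib (2 * n) : ℤ) = Nat.fib n * lucas n := by
  have h := two_mul_fib_add n n
  rw [← two_mul] at h
  linarith

theorem lucas_sq (n : ℕ) : (lucas n : ℤ) ^ 2 = 5 * (Nat.fib n : ℤ) ^ 2 + 4 * (-1) ^ n := by
  induction n with
  | zero => simp [lucas]
  | succ n ih =>
    have h1 := two_mul_fib_succ n
    have h2 := two_mul_lucas_succ n
    rw [pow_succ (-1 : ℤ)]
    grind

/-- In `ℤ[√5]`, `(1 + √5) ^ n = 2 ^ (n - 1) * (L n + F n * √5)`. -/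
theorem two_mul_one_add_sqrt_five_pow (n : ℕ) :
    2 * (⟨1, 1⟩ : ℤ√5) ^ n = 2 ^ n * ⟨lucas n, Nat.fib n⟩ := by
  induction n with
  | zero => ext <;> simp [lucas]
  | succ n ih =>
    have key : (⟨lucas n, Nat.fib n⟩ : ℤ√5) * ⟨1, 1⟩ =
        2 * ⟨lucas (n + 1), Nat.fib (n + 1)⟩ := by
      have h1 := two_mul_fib_succ n
      have h2 := two_mul_lucas_succ n
      ext <;> simp <;> linarith
    rw [pow_succ, ← mul_assoc, ih, mul_assoc, key, pow_succ]
    ring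

section Prime

variable {p : ℕ}

theorem isCoprime_of_not_dvd (hp : p.Prime) {c : ℤ} (hc : ¬ (p : ℤ) ∣ c) (k : ℕ) :
    IsCoprime ((p : ℤ) ^ k) c :=
  ((Nat.prime_iff_prime_int.1 hp).coprime_iff_not_dvd.2 hc).pow_left

theorem pow_dvd_of_pow_dvd_mul_left (hp : p.Prime) {c x : ℤ} {k : ℕ} (hc : ¬ (p : ℤ) ∣ c)
    (h : (p : ℤ) ^ k ∣ c * x) : (p : ℤ) ^ k ∣ x :=
  (isCoprime_of_not_dvd hp hc k).dvd_of_dvd_mul_left h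

theorem not_dvd_two (hp : p.Prime) (hp2 : p ≠ 2) : ¬ (p : ℤ) ∣ 2 := by
  intro h
  exact hp2 ((Nat.prime_dvd_prime_iff_eq hp Nat.prime_two).1 (by exact_mod_cast h))

theorem not_dvd_four (hp : p.Prime) (hp2 : p ≠ 2) : ¬ (p : ℤ) ∣ 4 := by
  intro h
  have h' : (p : ℤ) ∣ 2 ^ 2 := by norm_num [h]
  exact not_dvd_two hp hp2 ((Nat.prime_iff_prime_int.1 hp).dvd_of_dvd_pow h')

theorem not_dvd_four_mul_neg_one_pow (hp : p.Prime) (hp2 : p ≠ 2) (n : ℕ) :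
    ¬ (p : ℤ) ∣ 4 * (-1) ^ n := by
  rcases neg_one_pow_eq_or ℤ n with h | h <;> rw [h] <;> simpa using not_dvd_four hp hp2

theorem exists_nat_dvd_sub_mul (hp : p.Prime) {c : ℤ} (hc : ¬ (p : ℤ) ∣ c) (a : ℤ) :
    ∃ s : ℕ, (p : ℤ) ∣ a - c * s := by
  have := Fact.mk hp
  have hc' : (c : ZMod p) ≠ 0 := by rwa [Ne, ZMod.intCast_zmod_eq_zero_iff_dvd]
  refine ⟨((a : ZMod p) / c).val, ?_⟩
  rw [← ZMod.intCast_zmod_eq_zero_iff_dvd]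
  push_cast
  rw [ZMod.natCast_val, ZMod.cast_id]
  field_simp
  simp

theorem not_dvd_lucas_of_dvd_fib (hp : p.Prime) (hp2 : p ≠ 2) {n : ℕ}
    (h : (p : ℤ) ∣ Nat.fib n) : ¬ (p : ℤ) ∣ lucas n := by
  intro hl
  refine not_dvd_four_mul_neg_one_pow hp hp2 n ?_
  have h1 := lucas_sq n
  obtain ⟨a, ha⟩ := h
  obtain ⟨b, hb⟩ := hl
  rw [ha, hb] at h1
  exact ⟨p * b ^ 2 - 5 * (p * a ^ 2), by linarith⟩

/-- Square roots of units lift from `p ^ e` to `p ^ (e + k)`. -/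
theorem exists_sq_lift (hp : p.Prime) (hp2 : p ≠ 2) {e : ℕ} (he : 1 ≤ e) {w₀ c : ℤ}
    (hw : ¬ (p : ℤ) ∣ w₀) (h : (p : ℤ) ^ e ∣ c - w₀ ^ 2) (k : ℕ) :
    ∃ w, (p : ℤ) ^ e ∣ w - w₀ ∧ (p : ℤ) ^ (e + k) ∣ c - w ^ 2 := by
  induction k with
  | zero => exact ⟨w₀, by simp, h⟩
  | succ k ih =>
    obtain ⟨w, hw1, a, ha⟩ := ih
    have hpe : (p : ℤ) ∣ (p : ℤ) ^ e := dvd_pow_self _ (by omega)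
    have hwp : ¬ (p : ℤ) ∣ 2 * w := by
      intro hd
      rcases (Nat.prime_iff_prime_int.1 hp).dvd_or_dvd hd with h2 | h2
      · exact not_dvd_two hp hp2 h2
      · exact hw ((dvd_sub_right h2).1 (hpe.trans hw1))
    obtain ⟨s, b, hs⟩ := exists_nat_dvd_sub_mul hp hwp a
    refine ⟨w + p ^ (e + k) * s, ?_, ?_⟩
    · have : w + (p : ℤ) ^ (e + k) * s - w₀ = (w - w₀) + p ^ e * (p ^ k * s) := by ring
      rw [this]
      exact dvd_add hw1 (dvd_mul_right _ _)
    · obtain ⟨j, rfl⟩ : ∃ j, e = j + 1 := ⟨e - 1, by omega⟩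
      refine ⟨b - p ^ (j + k) * s ^ 2, ?_⟩
      have : c - (w + (p : ℤ) ^ (j + 1 + k) * s) ^ 2 =
        (c - w ^ 2) - 2 * w * s * p ^ (j + 1 + k) - (p ^ (j + 1 + k)) ^ 2 * s ^ 2 := by ring
      rw [this, ha, show a = p * b + 2 * w * s by linarith]
      ring

end Prime

theorem lucas_fib_prime_zmod {p : ℕ} [Fact p.Prime] (hp2 : p ≠ 2) :
    (lucas p : ZMod p) = 1 ∧ (Nat.fib p : ZMod p) = 5 ^ (p / 2) := by
  have hp : p.Prime := Fact.out
  have h2 : (2 : ZMod p) ≠ 0 := by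
    have h := not_dvd_two hp hp2
    rw [← ZMod.intCast_zmod_eq_zero_iff_dvd] at h
    simpa using h
  have hsq (m : ℕ) : (⟨0, 1⟩ : ℤ√5) ^ (2 * m + 1) = ⟨0, 5 ^ m⟩ := by
    induction m with
    | zero => simp
    | succ m ih =>
      rw [show 2 * (m + 1) + 1 = (2 * m + 1) + 2 by ring, pow_add, ih]
      ext <;> simp [pow_succ]
  have hodd : 2 * (p / 2) + 1 = p := by
    have := hp.eq_two_or_odd
    omega
  obtain ⟨r, hr⟩ := exists_add_pow_prime_eq hp (1 : ℤ√5) ⟨0, 1⟩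
  have key := two_mul_one_add_sqrt_five_pow p
  have hs : (⟨1, 1⟩ : ℤ√5) = 1 + ⟨0, 1⟩ := by ext <;> simp
  have hpow : (2 : ℤ√5) ^ p = ⟨2 ^ p, 0⟩ := by
    have : ((2 ^ p : ℤ) : ℤ√5) = 2 ^ p := by push_cast; rfl
    rw [← this]; ext <;> simp only [Zsqrtd.re_intCast, Zsqrtd.im_intCast]
  have hsp : (⟨0, 1⟩ : ℤ√5) ^ p = ⟨0, 5 ^ (p / 2)⟩ := by
    have := hsq (p / 2)
    rwa [hodd] at this
  rw [hs, hr, hpow, hsp, Zsqrtd.ext_iff] at key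
  simp at key
  obtain ⟨k1, k2⟩ := key
  have k1' := congrArg (Int.cast : ℤ → ZMod p) k1
  have k2' := congrArg (Int.cast : ℤ → ZMod p) k2
  push_cast at k1' k2'
  simp only [ZMod.pow_card, CharP.cast_eq_zero, zero_mul, mul_zero, add_zero] at k1' k2'
  exact ⟨(mul_left_cancel₀ h2 k1').symm, (mul_left_cancel₀ h2 k2').symm⟩

theorem legendreSym_five_right {p : ℕ} [Fact p.Prime] (hp2 : p ≠ 2) [Fact (Nat.Prime 5)] :
    legendreSym p 5 = legendreSym 5 p :=
  legendreSym.quadratic_reciprocity_one_mod_four (p := 5) (q := p) (by norm_num) hp2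

theorem five_pow_zmod {p : ℕ} [Fact p.Prime] (hp2 : p ≠ 2) :
    (p % 5 = 1 ∨ p % 5 = 4 → (5 : ZMod p) ^ (p / 2) = 1) ∧
      (p % 5 = 2 ∨ p % 5 = 3 → (5 : ZMod p) ^ (p / 2) = -1) := by
  have : Fact (Nat.Prime 5) := ⟨by norm_num⟩
  have h := legendreSym.eq_pow p 5
  rw [legendreSym_five_right hp2, legendreSym.mod] at h
  push_cast at h
  have hm : ((p : ℤ) % (5 : ℕ)) = ((p % 5 : ℕ) : ℤ) := by push_cast; rfl
  have h1 : legendreSym 5 1 = 1 := legendreSym.at_one 5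
  have h4 : @legendreSym 5 ⟨Nat.prime_five⟩ 4 = 1 := by decide
  have h2 : @legendreSym 5 ⟨Nat.prime_five⟩ 2 = -1 := by decide
  have h3 : @legendreSym 5 ⟨Nat.prime_five⟩ 3 = -1 := by decide
  constructor <;> rintro (h' | h') <;> simp_all

theorem prime_dvd_fib_pSubEps {p : ℕ} (hp : p.Prime) (hp2 : p ≠ 2) :
    (p : ℤ) ∣ Nat.fib (pSubEps p) := by
  have := Fact.mk hp
  obtain ⟨hL, hF⟩ := lucas_fib_prime_zmod (p := p) hp2
  obtain ⟨h1, h2⟩ := five_pow_zmod (p := p) hp2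
  unfold pSubEps
  split_ifs with c1 c2
  · refine pow_one (p : ℤ) ▸ pow_dvd_of_pow_dvd_mul_left hp (not_dvd_two hp hp2) ?_
    obtain ⟨q, rfl⟩ : ∃ q, p = q + 1 := ⟨p - 1, by have := hp.two_le; omega⟩
    have e1 := two_mul_fib_succ q
    have e2 := two_mul_lucas_succ q
    rw [h1 c1] at hF
    have hz : (2 : ℤ) * Nat.fib q = lucas (q + 1) - Nat.fib (q + 1) := by linarith
    rw [pow_one, Nat.add_sub_cancel, hz, ← ZMod.intCast_zmod_eq_zero_iff_dvd]
    push_cast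
    rw [hL, hF, sub_self]
  · refine pow_one (p : ℤ) ▸ pow_dvd_of_pow_dvd_mul_left hp (not_dvd_two hp hp2) ?_
    rw [pow_one, two_mul_fib_succ, ← ZMod.intCast_zmod_eq_zero_iff_dvd]
    push_cast
    rw [hL, hF, h2 c2]
    ring
  · have h5 : p = 5 := by
      have : 5 ∣ p := by omega
      exact ((Nat.prime_dvd_prime_iff_eq (by norm_num) hp).1 this).symm
    subst h5
    norm_num [Nat.fib]

/-- `m` is a (possibly zero) period modulo `p` of the Fibonacci sequence. -/
def IsFibPeriod (p m : ℕ) : Prop := (p : ℤ) ∣ Nat.fib m ∧ (p : ℤ) ∣ lucas m - 2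

section Period

variable {p : ℕ}

theorem pow_dvd_fib_add_sub (hp : p.Prime) (hp2 : p ≠ 2) {e d : ℕ}
    (hF : (p : ℤ) ^ e ∣ Nat.fib d) (hL : (p : ℤ) ^ e ∣ lucas d - 2) (n : ℕ) :
    (p : ℤ) ^ e ∣ Nat.fib (n + d) - Nat.fib n ∧ (p : ℤ) ^ e ∣ lucas (n + d) - lucas n := by
  obtain ⟨a, ha⟩ := hF
  obtain ⟨b, hb⟩ := hL
  have h1 := two_mul_fib_add n d
  have h2 := two_mul_lucas_add n d
  have hb' : (lucas d : ℤ) = 2 + p ^ e * b := by linarith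
  rw [ha, hb'] at h1 h2
  constructor <;> refine pow_dvd_of_pow_dvd_mul_left hp (not_dvd_two hp hp2) ?_
  · exact ⟨Nat.fib n * b + lucas n * a, by linarith⟩
  · exact ⟨lucas n * b + 5 * Nat.fib n * a, by linarith⟩

theorem isFibPeriod_iff (hp : p.Prime) (hp2 : p ≠ 2) {m : ℕ} :
    IsFibPeriod p m ↔ ∀ n, Nat.fib (n + m) ≡ Nat.fib n [MOD p] := by
  have hmod (n : ℕ) : Nat.fib (n + m) ≡ Nat.fib n [MOD p] ↔
      (p : ℤ) ∣ Nat.fib (n + m) - Nat.fib n := by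
    rw [Nat.ModEq.comm, Nat.modEq_iff_dvd]
  simp only [hmod]
  constructor
  · intro ⟨h1, h2⟩ n
    have := (pow_dvd_fib_add_sub hp hp2 (e := 1) (by simpa using h1) (by simpa using h2) n).1
    simpa using this
  · intro h
    have h0 := h 0
    have h1 := h 1
    rw [add_comm 1 m] at h1
    simp only [zero_add, Nat.fib_zero, Nat.cast_zero, sub_zero, Nat.fib_one, Nat.cast_one] at h0 h1
    refine ⟨h0, ?_⟩
    have h2 := two_mul_fib_succ m
    have h3 : (lucas m : ℤ) - 2 = 2 * (Nat.fib (m + 1) - 1) - Nat.fib m := by linarith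
    rw [h3]
    exact dvd_sub (h1.mul_left 2) h0

theorem fib_four_mul_eq (n : ℕ) :
    (Nat.fib (4 * n) : ℤ) = Nat.fib n * (lucas n * lucas (2 * n)) := by
  rw [show 4 * n = 2 * (2 * n) by ring, fib_two_mul_eq, fib_two_mul_eq, mul_assoc]

theorem isFibPeriod_four_mul (hp : p.Prime) (hp2 : p ≠ 2) {n : ℕ} (h : (p : ℤ) ∣ Nat.fib n) :
    IsFibPeriod p (4 * n) := by
  refine ⟨by rw [fib_four_mul_eq]; exact h.mul_right _, ?_⟩
  have h1 := two_mul_lucas_add n n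
  have h2 := two_mul_lucas_add (2 * n) (2 * n)
  rw [← two_mul] at h1 h2
  rw [← mul_assoc] at h2
  have h3 := lucas_sq n
  have h4 : (lucas (2 * n) : ℤ) = 2 * (-1) ^ n + 5 * Nat.fib n ^ 2 := by linarith
  have h5 : 2 * ((lucas (2 * 2 * n) : ℤ) - 2) =
      Nat.fib n * (10 * Nat.fib n * (4 * (-1) ^ n + 5 * Nat.fib n ^ 2)) := by
    have h6 : ((-1 : ℤ) ^ n) ^ 2 = 1 := by rw [← pow_mul, mul_comm, pow_mul]; simp
    rw [h4, fib_two_mul_eq] at h2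
    linear_combination h2 + 4 * h6 + 5 * (Nat.fib n : ℤ) ^ 2 * h3
  rw [show 4 * n = 2 * 2 * n by ring]
  refine pow_one (p : ℤ) ▸ pow_dvd_of_pow_dvd_mul_left hp (not_dvd_two hp hp2) ?_
  rw [h5, pow_one]
  exact h.mul_right _

theorem pSubEps_pos (hp : p.Prime) : 0 < pSubEps p := by
  have := hp.two_le
  unfold pSubEps
  split_ifs <;> omega

theorem pisano_mem (hp : p.Prime) (hp2 : p ≠ 2) : 1 ≤ pisano p ∧ IsFibPeriod p (pisano p) := by
  rw [isFibPeriod_iff hp hp2]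
  refine Nat.sInf_mem (s := {m | 1 ≤ m ∧ ∀ n, Nat.fib (n + m) ≡ Nat.fib n [MOD p]})
    ⟨4 * pSubEps p, ?_, ?_⟩
  · have := pSubEps_pos hp
    omega
  · rw [← isFibPeriod_iff hp hp2]
    exact isFibPeriod_four_mul hp hp2 (prime_dvd_fib_pSubEps hp hp2)

theorem pisano_dvd (hp : p.Prime) (hp2 : p ≠ 2) {m : ℕ} (h : IsFibPeriod p m) : pisano p ∣ m := by
  obtain ⟨h1, h2⟩ := pisano_mem hp hp2
  rw [isFibPeriod_iff hp hp2] at h h2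
  have hk (k n : ℕ) : Nat.fib (n + pisano p * k) ≡ Nat.fib n [MOD p] := by
    induction k with
    | zero => rfl
    | succ k ih => rw [mul_add, mul_one, ← add_assoc]; exact (h2 _).trans ih
  by_contra hd
  have hpos : 0 < m % pisano p := Nat.pos_of_ne_zero fun h0 => hd (Nat.dvd_of_mod_eq_zero h0)
  have hle : pisano p ≤ m % pisano p := by
    refine Nat.sInf_le ⟨hpos, fun n => ?_⟩
    refine (hk (m / pisano p) _).symm.trans ?_
    rw [add_assoc, Nat.mod_add_div]
    exact h n
  exact absurd (Nat.mod_lt m h1) (by omega)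

theorem IsFibPeriod.even (hp : p.Prime) (hp2 : p ≠ 2) {m : ℕ} (h : IsFibPeriod p m) :
    Even m := by
  by_contra ho
  rw [Nat.not_even_iff_odd] at ho
  obtain ⟨⟨a, ha⟩, ⟨b, hb⟩⟩ := h
  have h1 := lucas_sq m
  rw [ho.neg_one_pow, ha, show (lucas m : ℤ) = 2 + p * b by linarith] at h1
  have h8 : (p : ℤ) ∣ 2 * 4 := ⟨5 * p * a ^ 2 - p * b ^ 2 - 4 * b, by linarith⟩
  rcases (Nat.prime_iff_prime_int.1 hp).dvd_or_dvd h8 with h | h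
  · exact not_dvd_two hp hp2 h
  · exact not_dvd_four hp hp2 h

theorem IsFibPeriod.pow_dvd_lucas_sub_two (hp : p.Prime) (hp2 : p ≠ 2) {m l : ℕ}
    (h : IsFibPeriod p m) (hl : (p : ℤ) ^ l ∣ Nat.fib m) :
    (p : ℤ) ^ (2 * l) ∣ lucas m - 2 := by
  have h4 : ¬ (p : ℤ) ∣ lucas m + 2 := by
    intro hd
    apply not_dvd_four hp hp2
    have := dvd_sub hd h.2
    ring_nf at this
    exact this
  refine pow_dvd_of_pow_dvd_mul_left hp h4 ?_
  have h1 := lucas_sq m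
  rw [(h.even hp hp2).neg_one_pow] at h1
  obtain ⟨a, ha⟩ := hl
  rw [ha] at h1
  exact ⟨5 * a ^ 2, by linear_combination h1⟩

theorem fib_lucas_mul_approx (hp : p.Prime) (hp2 : p ≠ 2) {d l : ℕ}
    (hF : (p : ℤ) ^ l ∣ Nat.fib d) (hL : (p : ℤ) ^ (2 * l) ∣ lucas d - 2) (t : ℕ) :
    (p : ℤ) ^ (2 * l) ∣ lucas (d * t) - 2 ∧ (p : ℤ) ^ (3 * l) ∣ Nat.fib (d * t) - t * Nat.fib d := by
  induction t with
  | zero => simp [lucas]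
  | succ t ih =>
    obtain ⟨⟨x, hx⟩, ⟨y, hy⟩⟩ := ih
    obtain ⟨a, ha⟩ := hF
    obtain ⟨b, hb⟩ := hL
    have h1 := two_mul_fib_add (d * t) d
    have h2 := two_mul_lucas_add (d * t) d
    rw [show d * t + d = d * (t + 1) by ring] at h1 h2
    have hb' : (lucas d : ℤ) = 2 + p ^ (2 * l) * b := by linarith
    have hx' : (lucas (d * t) : ℤ) = 2 + p ^ (2 * l) * x := by linarith
    have hy' : (Nat.fib (d * t) : ℤ) = t * (p ^ l * a) + p ^ (3 * l) * y := by
      rw [← ha]; linarith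
    rw [hb', hx', hy', ha] at h1 h2
    constructor <;> refine pow_dvd_of_pow_dvd_mul_left hp (not_dvd_two hp hp2) ?_
    · refine ⟨2 * b + 2 * x + p ^ (2 * l) * b * x + 5 * (t * a + p ^ (2 * l) * y) * a, ?_⟩
      rw [mul_sub, h2]
      ring
    · refine ⟨2 * y + p ^ (2 * l) * b * y + t * a * b + x * a, ?_⟩
      rw [mul_sub, h1, ha]
      push_cast
      ring

end Period

section Wall

variable {p : ℕ}

theorem wallExp_spec (hp : p.Prime) (hp2 : p ≠ 2) :
    1 ≤ wallExp p ∧ (p : ℤ) ^ wallExp p ∣ Nat.fib (pSubEps p) ∧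
      ¬ (p : ℤ) ^ (wallExp p + 1) ∣ Nat.fib (pSubEps p) := by
  have := Fact.mk hp
  have h0 : Nat.fib (pSubEps p) ≠ 0 := (Nat.fib_pos.2 (pSubEps_pos hp)).ne'
  refine ⟨one_le_padicValNat_of_dvd h0 (by exact_mod_cast prime_dvd_fib_pSubEps hp hp2), ?_, ?_⟩
  · exact_mod_cast pow_padicValNat_dvd
  · exact_mod_cast pow_succ_padicValNat_not_dvd h0

theorem pow_dvd_fib_four_mul (hp : p.Prime) (hp2 : p ≠ 2) {n k : ℕ} (h : (p : ℤ) ∣ Nat.fib n)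
    (hk : (p : ℤ) ^ k ∣ Nat.fib (4 * n)) : (p : ℤ) ^ k ∣ Nat.fib n := by
  have h2 : (p : ℤ) ∣ Nat.fib (2 * n) := by
    rw [fib_two_mul_eq]; exact h.mul_right _
  rw [fib_four_mul_eq, mul_comm, mul_assoc] at hk
  exact pow_dvd_of_pow_dvd_mul_left hp (not_dvd_lucas_of_dvd_fib hp hp2 h2)
    (pow_dvd_of_pow_dvd_mul_left hp (not_dvd_lucas_of_dvd_fib hp hp2 h) hk)

theorem fib_dvd_fib_int {m n : ℕ} (h : m ∣ n) : (Nat.fib m : ℤ) ∣ Nat.fib n := by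
  exact_mod_cast Nat.fib_dvd m n h

theorem wallExp_five : wallExp 5 = 1 := by
  have := Fact.mk Nat.prime_five
  have h : Nat.fib (pSubEps 5) = 5 := by decide
  rw [wallExp, h, padicValNat.self (by norm_num)]

theorem eq_five_or_not_dvd_pSubEps (hp : p.Prime) : p = 5 ∨ ¬ p ∣ pSubEps p := by
  have h2 := hp.two_le
  unfold pSubEps
  split_ifs with h h'
  · exact Or.inr fun hd => absurd (Nat.le_of_dvd (by omega) hd) (by omega)
  · refine Or.inr fun hd => ?_
    have := Nat.le_of_dvd one_pos ((Nat.dvd_add_right dvd_rfl).1 hd)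
    omega
  · have : 5 ∣ p := by omega
    exact Or.inl ((Nat.prime_dvd_prime_iff_eq (by norm_num) hp).1 this).symm

theorem fib_pisano_exact (hp : p.Prime) (hp2 : p ≠ 2) :
    (p : ℤ) ^ wallExp p ∣ Nat.fib (pisano p) ∧
      ¬ (p : ℤ) ^ (wallExp p + 1) ∣ Nat.fib (pisano p) := by
  have := Fact.mk hp
  obtain ⟨he, hR, hR'⟩ := wallExp_spec hp hp2
  obtain ⟨hpos, hper⟩ := pisano_mem hp hp2
  have hpR := prime_dvd_fib_pSubEps hp hp2
  have hdvd : pisano p ∣ 4 * pSubEps p := pisano_dvd hp hp2 (isFibPeriod_four_mul hp hp2 hpR)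
  have h0 : Nat.fib (pisano p) ≠ 0 := (Nat.fib_pos.2 hpos).ne'
  obtain ⟨f, hfdef⟩ : ∃ f, f = padicValNat p (Nat.fib (pisano p)) := ⟨_, rfl⟩
  have hf1 : 1 ≤ f := hfdef ▸ one_le_padicValNat_of_dvd h0 (by exact_mod_cast hper.1)
  have hf : (p : ℤ) ^ f ∣ Nat.fib (pisano p) := by
    rw [hfdef]; exact_mod_cast pow_padicValNat_dvd
  have hf' : ¬ (p : ℤ) ^ (f + 1) ∣ Nat.fib (pisano p) := by
    rw [hfdef]; exact_mod_cast pow_succ_padicValNat_not_dvd h0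
  suffices h : f = wallExp p by rw [← h]; exact ⟨hf, hf'⟩
  apply le_antisymm
  · by_contra! hlt
    exact hR' (pow_dvd_fib_four_mul hp hp2 hpR
      ((pow_dvd_pow _ hlt).trans (hf.trans (fib_dvd_fib_int hdvd))))
  · rcases eq_five_or_not_dvd_pSubEps hp with rfl | hnd
    · rw [wallExp_five]; exact hf1
    obtain ⟨k, hk⟩ := hdvd
    have hpk : ¬ (p : ℤ) ∣ k := by
      intro hd
      have hd' : p ∣ 4 * pSubEps p := hk ▸ (Int.natCast_dvd_natCast.1 hd).mul_left _
      rcases hp.dvd_mul.1 hd' with h | h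
      · exact not_dvd_four hp hp2 (by exact_mod_cast h)
      · exact hnd h
    by_contra! hlt
    apply hf'
    refine pow_dvd_of_pow_dvd_mul_left hp hpk ?_
    have h1 := (fib_lucas_mul_approx hp hp2 hf (hper.pow_dvd_lucas_sub_two hp hp2 hf) k).2
    rw [← hk] at h1
    have h2 : (p : ℤ) ^ (f + 1) ∣ Nat.fib (4 * pSubEps p) :=
      ((pow_dvd_pow _ hlt).trans hR).trans (fib_dvd_fib_int (Dvd.intro_left 4 rfl))
    exact (dvd_sub_right h2).1 ((pow_dvd_pow _ (by omega)).trans h1)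

theorem IsFibPeriod.mul_right (hp : p.Prime) (hp2 : p ≠ 2) {d : ℕ} (h : IsFibPeriod p d)
    (t : ℕ) : IsFibPeriod p (d * t) := by
  have h1 : (p : ℤ) ^ 1 ∣ Nat.fib d := by simpa using h.1
  have h2 := (fib_lucas_mul_approx hp hp2 h1 (h.pow_dvd_lucas_sub_two hp hp2 h1) t).1
  exact ⟨h.1.trans (fib_dvd_fib_int (Dvd.intro t rfl)), (dvd_pow_self _ (by norm_num)).trans h2⟩

theorem fib_pisano_mul_pow_exact (hp : p.Prime) (hp2 : p ≠ 2) (k : ℕ) :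
    (p : ℤ) ^ (wallExp p + k) ∣ Nat.fib (pisano p * p ^ k) ∧
      ¬ (p : ℤ) ^ (wallExp p + k + 1) ∣ Nat.fib (pisano p * p ^ k) := by
  induction k with
  | zero => simpa using fib_pisano_exact hp hp2
  | succ k ih =>
    have he := (wallExp_spec hp hp2).1
    have hper := (pisano_mem hp hp2).2.mul_right hp hp2 (p ^ k)
    have h1 := (fib_lucas_mul_approx hp hp2 ih.1 (hper.pow_dvd_lucas_sub_two hp hp2 ih.1) p).2
    rw [mul_assoc, ← pow_succ] at h1
    have h2 : (p : ℤ) ^ (wallExp p + k + 1 + 1) ∣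
        Nat.fib (pisano p * p ^ (k + 1)) - p * Nat.fib (pisano p * p ^ k) :=
      (pow_dvd_pow _ (by omega)).trans h1
    constructor
    · rw [← add_assoc]
      refine (dvd_iff_dvd_of_dvd_sub ((pow_dvd_pow _ (by omega)).trans h2)).2 ?_
      rw [pow_succ']
      exact mul_dvd_mul_left _ ih.1
    · rw [← add_assoc]
      intro h
      have h3 := (dvd_iff_dvd_of_dvd_sub h2).1 h
      rw [pow_succ'] at h3
      exact ih.2 (Int.dvd_of_mul_dvd_mul_left (by exact_mod_cast hp.ne_zero) h3)

theorem pow_wallExp_dvd_lucas (hp : p.Prime) (hp2 : p ≠ 2) {i : ℕ} (h : (p : ℤ) ∣ lucas i) :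
    (p : ℤ) ^ wallExp p ∣ lucas i := by
  have hF : ¬ (p : ℤ) ∣ Nat.fib i := fun hd => not_dvd_lucas_of_dvd_fib hp hp2 hd h
  have h2 : (p : ℤ) ∣ Nat.fib (2 * i) := by
    rw [fib_two_mul_eq]; exact h.mul_left _
  have h8 := isFibPeriod_four_mul hp hp2 h2
  have h3 := (fib_pisano_exact hp hp2).1.trans (fib_dvd_fib_int (pisano_dvd hp hp2 h8))
  have h4 := pow_dvd_fib_four_mul hp hp2 h2 h3
  rw [fib_two_mul_eq] at h4
  exact pow_dvd_of_pow_dvd_mul_left hp hF h4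

theorem fib_lucas_add_pisano_mul (hp : p.Prime) (hp2 : p ≠ 2) (i t : ℕ) :
    (p : ℤ) ^ wallExp p ∣ Nat.fib (i + pisano p * t) - Nat.fib i ∧
      (p : ℤ) ^ wallExp p ∣ lucas (i + pisano p * t) - lucas i := by
  have hF := (fib_pisano_exact hp hp2).1.trans (fib_dvd_fib_int (Dvd.intro t rfl))
  have hL := ((pisano_mem hp hp2).2.mul_right hp hp2 t).pow_dvd_lucas_sub_two hp hp2 hF
  exact pow_dvd_fib_add_sub hp hp2 hF ((pow_dvd_pow _ (by omega)).trans hL) i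

theorem neg_one_pow_add_pisano_mul (hp : p.Prime) (hp2 : p ≠ 2) (i t : ℕ) :
    (-1 : ℤ) ^ (i + pisano p * t) = (-1) ^ i := by
  rw [pow_add, (((pisano_mem hp hp2).2.mul_right hp hp2 t).even hp hp2).neg_one_pow, mul_one]

/-- Every point of the conic `w ^ 2 - 5 * v ^ 2 = ± 4` modulo a power of `p` which reduces to
`(F i, L i)` modulo `p ^ e` is of the form `(F n, L n)` with `n ≡ i` modulo the period. -/
theorem exists_fib_lucas_of_conic (hp : p.Prime) (hp2 : p ≠ 2) (i : ℕ) {v w : ℤ}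
    (hv : (p : ℤ) ^ wallExp p ∣ v - Nat.fib i) (hw : (p : ℤ) ^ wallExp p ∣ w - lucas i) (k : ℕ)
    (hc : (p : ℤ) ^ (wallExp p + k) ∣ w ^ 2 - 5 * v ^ 2 - 4 * (-1) ^ i) :
    ∃ t, (p : ℤ) ^ (wallExp p + k) ∣ v - Nat.fib (i + pisano p * t) ∧
      (p : ℤ) ^ (wallExp p + k) ∣ w - lucas (i + pisano p * t) := by
  induction k with
  | zero => exact ⟨0, by simpa using hv, by simpa using hw⟩
  | succ k ih =>
    obtain ⟨t, ht⟩ := ih ((pow_dvd_pow _ (by omega)).trans hc)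
    have hsq := lucas_sq (i + pisano p * t)
    rw [neg_one_pow_add_pisano_mul hp hp2] at hsq
    have he := (wallExp_spec hp hp2).1
    have hper := (pisano_mem hp hp2).2.mul_right hp hp2 (p ^ k)
    obtain ⟨hd, hd'⟩ := fib_pisano_mul_pow_exact hp hp2 k
    have happ := fib_lucas_mul_approx hp hp2 hd (hper.pow_dvd_lucas_sub_two hp hp2 hd)
    have hadd (s : ℕ) := fib_lucas_add (i + pisano p * t) (pisano p * p ^ k * s)
    have hidx (s : ℕ) : i + pisano p * t + pisano p * p ^ k * s =
        i + pisano p * (t + p ^ k * s) := by ring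
    simp only [hidx] at hadd
    rw [← add_assoc] at hc ⊢
    obtain ⟨u, hu⟩ := hd
    have hpu : ¬ (p : ℤ) ∣ u := by
      rintro ⟨u', rfl⟩
      exact hd' ⟨u', by rw [hu]; ring⟩
    generalize (Nat.fib (i + pisano p * t) : ℤ) = F at *
    generalize (lucas (i + pisano p * t) : ℤ) = L at *
    generalize hlam : wallExp p + k = l at *
    obtain ⟨⟨a, ha⟩, ⟨b, hb⟩⟩ := ht
    obtain ⟨j, rfl⟩ : ∃ j, l = j + 1 := ⟨l - 1, by omega⟩
    have hp0 : (p : ℤ) ≠ 0 := by exact_mod_cast hp.ne_zero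
    have hprime := Nat.prime_iff_prime_int.1 hp
    have h2 := not_dvd_two hp hp2
    have hab : (p : ℤ) ∣ L * b - 5 * F * a := by
      refine pow_one (p : ℤ) ▸ pow_dvd_of_pow_dvd_mul_left hp h2 ?_
      obtain ⟨c, hc⟩ := hc
      rw [show w = L + p ^ (j + 1) * b by linarith, show v = F + p ^ (j + 1) * a by linarith] at hc
      refine ⟨c + p ^ j * (5 * a ^ 2 - b ^ 2), ?_⟩
      refine mul_left_cancel₀ (pow_ne_zero (j + 1) hp0) ?_
      linear_combination hc - hsq
    suffices hs : ∃ s : ℕ, (p : ℤ) ∣ 2 * a - L * u * s ∧ (p : ℤ) ∣ 2 * b - 5 * F * u * s by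
      obtain ⟨s, ⟨a', ha'⟩, ⟨b', hb'⟩⟩ := hs
      refine ⟨t + p ^ k * s, ?_, ?_⟩ <;> refine pow_dvd_of_pow_dvd_mul_left hp h2 ?_ <;>
        obtain ⟨⟨x, hx⟩, ⟨y, hy⟩⟩ := happ s <;>
        rw [hu] at hy <;>
        obtain ⟨hadd1, hadd2⟩ := hadd s <;>
        rw [show (lucas (pisano p * p ^ k * s) : ℤ) = 2 + p ^ (2 * (j + 1)) * x by linarith,
          show (Nat.fib (pisano p * p ^ k * s) : ℤ) =
            s * (p ^ (j + 1) * u) + p ^ (3 * (j + 1)) * y by linarith] at hadd1 hadd2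
      · refine ⟨a' - p ^ j * F * x - p ^ (2 * j + 1) * L * y, ?_⟩
        rw [mul_sub, hadd1, show v = F + p ^ (j + 1) * a by linarith]
        linear_combination (p : ℤ) ^ (j + 1) * ha'
      · refine ⟨b' - p ^ j * L * x - 5 * p ^ (2 * j + 1) * F * y, ?_⟩
        rw [mul_sub, hadd2, show w = L + p ^ (j + 1) * b by linarith]
        linear_combination (p : ℤ) ^ (j + 1) * hb'
    by_cases hL : (p : ℤ) ∣ L
    · have h5F : ¬ (p : ℤ) ∣ 5 * F := by
        intro h
        refine not_dvd_four_mul_neg_one_pow hp hp2 i ?_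
        have e1 : 4 * (-1 : ℤ) ^ i = L * L - 5 * F * F := by linarith
        rw [e1]
        exact dvd_sub (hL.mul_right _) (h.mul_right _)
      have h5Fu : ¬ (p : ℤ) ∣ 5 * F * u := fun h => (hprime.dvd_or_dvd h).elim h5F hpu
      obtain ⟨s, hs⟩ := exists_nat_dvd_sub_mul hp h5Fu (2 * b)
      refine ⟨s, ?_, hs⟩
      have ha0 : (p : ℤ) ∣ a := by
        have := (dvd_sub_right (hL.mul_right b)).1 hab
        exact (hprime.dvd_or_dvd this).resolve_left h5F
      exact dvd_sub (ha0.mul_left _) ((hL.mul_right _).mul_right _)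
    · have hLu : ¬ (p : ℤ) ∣ L * u := fun h => (hprime.dvd_or_dvd h).elim hL hpu
      obtain ⟨s, hs⟩ := exists_nat_dvd_sub_mul hp hLu (2 * a)
      refine ⟨s, hs, ?_⟩
      refine (hprime.dvd_or_dvd (?_ : (p : ℤ) ∣ L * (2 * b - 5 * F * u * s))).resolve_left hL
      have : L * (2 * b - 5 * F * u * s) =
        2 * (L * b - 5 * F * a) + 5 * F * (2 * a - L * u * s) := by ring
      rw [this]
      exact dvd_add (hab.mul_left _) (hs.mul_left _)

end Wall

theorem Set.ncard_range_eq_of_eq_iff {ι α β : Type*} {f : ι → α} {g : ι → β}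
    (h : ∀ s t, f s = f t ↔ g s = g t) : (Set.range f).ncard = (Set.range g).ncard := by
  have hk : Setoid.ker f = Setoid.ker g := Setoid.ext h
  rw [← Nat.card_coe_set_eq, ← Nat.card_coe_set_eq,
    ← Nat.card_congr (Setoid.quotientKerEquivRange f),
    ← Nat.card_congr (Setoid.quotientKerEquivRange g), hk]

theorem intCast_zmod_pow_eq_iff {p k : ℕ} {a b : ℤ} :
    (a : ZMod (p ^ k)) = b ↔ (p : ℤ) ^ k ∣ a - b := by
  rw [← sub_eq_zero, ← Int.cast_sub, ZMod.intCast_zmod_eq_zero_iff_dvd, Nat.cast_pow]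

/-- The number of squares modulo `p ^ k`. -/
noncomputable def numSquares (p k : ℕ) : ℕ :=
  (Set.range fun s : ℤ => ((s ^ 2 : ℤ) : ZMod (p ^ k))).ncard

section Count

variable {p : ℕ}

theorem ncard_range_pow_mul_sq (hp : p.Prime) (j k : ℕ) :
    (Set.range fun s : ℤ => (((p ^ j * s) ^ 2 : ℤ) : ZMod (p ^ (j + (j + k))))).ncard =
      numSquares p k := by
  refine Set.ncard_range_eq_of_eq_iff fun s t => ?_
  rw [intCast_zmod_pow_eq_iff, intCast_zmod_pow_eq_iff]
  have h : ((p : ℤ) ^ j * s) ^ 2 - (p ^ j * t) ^ 2 = p ^ (2 * j) * (s ^ 2 - t ^ 2) := by ring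
  rw [h, show j + (j + k) = 2 * j + k by ring, pow_add]
  have hp0 : (p : ℤ) ≠ 0 := by exact_mod_cast hp.ne_zero
  exact mul_dvd_mul_iff_left (pow_ne_zero _ hp0)

theorem two_mul_card_range_sq_units (hp : p.Prime) (hp2 : p ≠ 2) (k : ℕ) :
    2 * Nat.card (powMonoidHom 2 : (ZMod (p ^ (k + 1)))ˣ →* _).range = p ^ k * (p - 1) := by
  have : NeZero (p ^ (k + 1)) := ⟨pow_ne_zero _ hp.ne_zero⟩
  have : Fact (2 < p ^ (k + 1)) :=
    ⟨lt_of_lt_of_le (by have := hp.two_le; omega) (Nat.le_self_pow (by omega) p)⟩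
  have hker : Nat.card (powMonoidHom 2 : (ZMod (p ^ (k + 1)))ˣ →* _).ker = 2 := by
    have hset : (((powMonoidHom 2 : (ZMod (p ^ (k + 1)))ˣ →* _).ker : Subgroup _) :
        Set (ZMod (p ^ (k + 1)))ˣ) = {1, -1} := by
      ext x
      simp only [SetLike.mem_coe, MonoidHom.mem_ker, powMonoidHom_apply, Set.mem_insert_iff,
        Set.mem_singleton_iff]
      constructor
      · intro hx
        obtain ⟨a, ha⟩ := ZMod.intCast_surjective (x : ZMod (p ^ (k + 1)))
        have hx' : ((a ^ 2 : ℤ) : ZMod (p ^ (k + 1))) = (1 : ℤ) := by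
          push_cast
          rw [ha, ← Units.val_pow_eq_pow_val, hx, Units.val_one]
        rw [intCast_zmod_pow_eq_iff, show a ^ 2 - 1 = (a + 1) * (a - 1) by ring] at hx'
        by_cases h1 : (p : ℤ) ∣ a + 1
        · right
          have h2 : ¬ (p : ℤ) ∣ a - 1 := by
            intro h2
            have h3 := dvd_sub h1 h2
            ring_nf at h3
            exact not_dvd_two hp hp2 h3
          rw [mul_comm] at hx'
          have h3 := pow_dvd_of_pow_dvd_mul_left hp h2 hx'
          rw [← sub_neg_eq_add, ← intCast_zmod_pow_eq_iff, ha] at h3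
          ext
          simpa using h3
        · left
          have h3 := pow_dvd_of_pow_dvd_mul_left hp h1 hx'
          rw [← intCast_zmod_pow_eq_iff, ha] at h3
          ext
          simpa using h3
      · rintro (rfl | rfl) <;> simp
    have hne : (1 : (ZMod (p ^ (k + 1)))ˣ) ≠ -1 := by
      intro h
      exact ZMod.neg_one_ne_one (congrArg Units.val h).symm
    exact (congrArg Set.ncard hset).trans (Set.ncard_pair hne)
  have h := Subgroup.card_mul_index (powMonoidHom 2 : (ZMod (p ^ (k + 1)))ˣ →* _).ker
  rw [Subgroup.index_ker, hker, Nat.card_eq_fintype_card (α := (ZMod (p ^ (k + 1)))ˣ),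
    ZMod.card_units_eq_totient, Nat.totient_prime_pow_succ hp] at h
  exact h

theorem two_mul_numSquares_add_two (hp : p.Prime) (hp2 : p ≠ 2) (k : ℕ) :
    2 * numSquares p (k + 2) = p ^ (k + 1) * (p - 1) + 2 * numSquares p k := by
  have : NeZero (p ^ (k + 2)) := ⟨pow_ne_zero _ hp.ne_zero⟩
  have : NeZero (p ^ (1 + (1 + k))) := ⟨pow_ne_zero _ hp.ne_zero⟩
  have hu (a : ℤ) : IsUnit (a : ZMod (p ^ (1 + (1 + k)))) ↔ ¬ (p : ℤ) ∣ a := by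
    rw [ZMod.coe_int_isUnit_iff_isCoprime, Nat.cast_pow, IsCoprime.pow_left_iff (by omega)]
    exact (Nat.prime_iff_prime_int.1 hp).coprime_iff_not_dvd
  rw [← two_mul_card_range_sq_units hp hp2 (k + 1), ← ncard_range_pow_mul_sq hp 1 k, ← mul_add]
  congr 1
  rw [numSquares, show k + 1 + 1 = 1 + (1 + k) by ring]
  have hunit : Nat.card (powMonoidHom 2 : (ZMod (p ^ (1 + (1 + k))))ˣ →* _).range =
      (Units.val '' ((powMonoidHom 2 : (ZMod (p ^ (1 + (1 + k))))ˣ →* _).range :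
        Set (ZMod (p ^ (1 + (1 + k))))ˣ)).ncard := by
    rw [Set.ncard_image_of_injective _ Units.val_injective, ← Nat.card_coe_set_eq]
    rfl
  rw [hunit, ← Set.ncard_union_eq ?_ (Set.toFinite _) (Set.toFinite _)]
  · congr 1
    ext x
    simp only [Set.mem_range, Set.mem_union, Set.mem_image, SetLike.mem_coe, MonoidHom.mem_range,
      powMonoidHom_apply, exists_exists_eq_and, pow_one]
    constructor
    · rintro ⟨s, rfl⟩
      by_cases hs : (p : ℤ) ∣ s
      · obtain ⟨t, rfl⟩ := hs
        exact Or.inr ⟨t, rfl⟩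
      · obtain ⟨y, hy⟩ := (hu s).2 hs
        exact Or.inl ⟨y, by push_cast; rw [hy]⟩
    · rintro (⟨y, rfl⟩ | ⟨t, rfl⟩)
      · obtain ⟨a, ha⟩ := ZMod.intCast_surjective (y : ZMod (p ^ (1 + (1 + k))))
        exact ⟨a, by push_cast; rw [ha]⟩
      · exact ⟨p * t, rfl⟩
  · rw [Set.disjoint_left]
    rintro _ ⟨y, _, rfl⟩ ⟨t, ht⟩
    have h := y.isUnit
    simp only at ht
    rw [← ht, hu] at h
    exact h ⟨p * t ^ 2, by ring⟩

theorem tendsto_numSquares_div (hp : p.Prime) (hp2 : p ≠ 2) :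
    Filter.Tendsto (fun k => (numSquares p k : ℝ) / (p : ℝ) ^ k) Filter.atTop
      (nhds ((p : ℝ) / (2 * (p + 1)))) := by
  have hp1 : (1 : ℝ) < p := by exact_mod_cast hp.one_lt
  have hp0 : (0 : ℝ) < p := by linarith
  obtain ⟨c, hc⟩ : ∃ c : ℝ, c = p / (2 * (p + 1)) := ⟨_, rfl⟩
  have hrec (k : ℕ) : (numSquares p (k + 2) : ℝ) - c * p ^ (k + 2) =
      numSquares p k - c * p ^ k := by
    have h : 2 * (numSquares p (k + 2) : ℝ) = p ^ (k + 1) * (p - 1) + 2 * numSquares p k := by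
      have h := congrArg (Nat.cast : ℕ → ℝ) (two_mul_numSquares_add_two hp hp2 k)
      push_cast [Nat.cast_sub hp.one_le] at h
      exact h
    have h' : c * (p + 1) * 2 = p := by rw [hc]; field_simp
    linear_combination h / 2 - (p : ℝ) ^ k * (p - 1) / 2 * h'
  obtain ⟨C, hC⟩ : ∃ C, ∀ k, |(numSquares p k : ℝ) - c * p ^ k| ≤ C := by
    refine ⟨max |(numSquares p 0 : ℝ) - c * p ^ 0| |(numSquares p 1 : ℝ) - c * p ^ 1|, fun k => ?_⟩
    induction k using Nat.twoStepInduction with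
    | zero => exact le_max_left _ _
    | one => exact le_max_right _ _
    | more k h _ => rw [hrec]; exact h
  rw [← hc, tendsto_iff_norm_sub_tendsto_zero]
  have hlim : Filter.Tendsto (fun k : ℕ => C * ((p : ℝ)⁻¹) ^ k) Filter.atTop (nhds 0) := by
    simpa using (tendsto_pow_atTop_nhds_zero_of_lt_one (inv_nonneg.2 hp0.le)
      (inv_lt_one_of_one_lt₀ hp1)).const_mul C
  refine squeeze_zero (fun _ => norm_nonneg _) (fun k => ?_) hlim
  have hpk : (0 : ℝ) < p ^ k := pow_pos hp0 k
  have : (numSquares p k : ℝ) / p ^ k - c = (numSquares p k - c * p ^ k) / p ^ k := by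
    field_simp
  rw [this, norm_div, Real.norm_eq_abs, Real.norm_eq_abs, abs_of_pos hpk, inv_pow,
    ← div_eq_mul_inv]
  exact div_le_div_of_nonneg_right (hC k) hpk.le

end Count

section Fibers

variable {p : ℕ}

/-- The residues of Fibonacci numbers modulo `p ^ (e + k)` lying above a class modulo `p ^ e`,
where `e = wallExp p`. -/
def fibFiber (p k : ℕ) (r : ZMod (p ^ wallExp p)) : Set (ZMod (p ^ (wallExp p + k))) :=
  {x | (∃ n : ℕ, (Nat.fib n : ZMod (p ^ (wallExp p + k))) = x) ∧
    ZMod.castHom (pow_dvd_pow p (Nat.le_add_right _ k)) (ZMod (p ^ wallExp p)) x = r}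

theorem natCast_zmod_pow_eq_iff {k a b : ℕ} :
    (a : ZMod (p ^ k)) = b ↔ (p : ℤ) ^ k ∣ a - b := by
  rw [← intCast_zmod_pow_eq_iff]
  push_cast
  rfl

theorem fibFiber_ncard_of_not_dvd_lucas (hp : p.Prime) (hp2 : p ≠ 2) {i : ℕ}
    (hi : ¬ p ∣ lucas i) (k : ℕ) : (fibFiber p k (Nat.fib i)).ncard = p ^ k := by
  have hi' : ¬ (p : ℤ) ∣ lucas i := by exact_mod_cast hi
  have he := (wallExp_spec hp hp2).1
  have hset : fibFiber p k (Nat.fib i) = Set.range fun s : ℤ =>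
      ((Nat.fib i + p ^ wallExp p * s : ℤ) : ZMod (p ^ (wallExp p + k))) := by
    ext x
    constructor
    · rintro ⟨⟨n, rfl⟩, hn⟩
      rw [map_natCast, natCast_zmod_pow_eq_iff] at hn
      obtain ⟨s, hs⟩ := hn
      exact ⟨s, by simp only [← hs, add_sub_cancel, Int.cast_natCast]⟩
    · rintro ⟨s, rfl⟩
      beta_reduce
      refine ⟨?_, ?_⟩
      swap
      · rw [map_intCast, ← Int.cast_natCast (R := ZMod (p ^ wallExp p)) (Nat.fib i),
          intCast_zmod_pow_eq_iff]
        simp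
      have hv : (p : ℤ) ^ wallExp p ∣ (Nat.fib i + p ^ wallExp p * s) - Nat.fib i := by simp
      generalize (Nat.fib i + p ^ wallExp p * s : ℤ) = v at *
      obtain ⟨w, hw, hw'⟩ := exists_sq_lift hp hp2 he hi' (c := 5 * v ^ 2 + 4 * (-1) ^ i) (by
        rw [lucas_sq]
        obtain ⟨a, ha⟩ := hv
        exact ⟨5 * a * (v + Nat.fib i), by linear_combination 5 * (v + Nat.fib i) * ha⟩) k
      obtain ⟨t, ht, _⟩ := exists_fib_lucas_of_conic hp hp2 i hv hw k (by
        rw [← dvd_neg]; ring_nf at hw' ⊢; exact hw')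
      refine ⟨i + pisano p * t, ?_⟩
      rw [← intCast_zmod_pow_eq_iff] at ht
      rw [ht, Int.cast_natCast]
  have hrange : (Set.range fun s : ℤ => (s : ZMod (p ^ k))).ncard = p ^ k := by
    rw [ZMod.intCast_surjective.range_eq, Set.ncard_univ, Nat.card_zmod]
  rw [hset, ← hrange]
  refine Set.ncard_range_eq_of_eq_iff fun s t => ?_
  rw [intCast_zmod_pow_eq_iff, intCast_zmod_pow_eq_iff, add_sub_add_left_eq_sub, ← mul_sub,
    pow_add]
  exact mul_dvd_mul_iff_left (pow_ne_zero _ (by exact_mod_cast hp.ne_zero))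

theorem not_dvd_five_mul_fib (hp : p.Prime) (hp2 : p ≠ 2) {i : ℕ} (hi : (p : ℤ) ∣ lucas i) :
    ¬ (p : ℤ) ∣ 5 * Nat.fib i := by
  intro h
  refine not_dvd_four_mul_neg_one_pow hp hp2 i ?_
  have h1 := lucas_sq i
  rw [show 4 * (-1 : ℤ) ^ i = lucas i * lucas i - 5 * Nat.fib i * Nat.fib i by linarith]
  exact dvd_sub (hi.mul_right _) (h.mul_right _)

/-- Lucas zeros are determined modulo the period by their Fibonacci residue modulo `p`. -/
theorem lucas_zero_unique (hp : p.Prime) (hp2 : p ≠ 2) {i j : ℕ} (hi : p ∣ lucas i)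
    (hj : p ∣ lucas j) (hi' : i < pisano p) (hj' : j < pisano p)
    (h : (p : ℤ) ∣ Nat.fib i - Nat.fib j) : i = j := by
  wlog hle : i ≤ j generalizing i j
  · exact (this hj hi hj' hi' (by rwa [dvd_sub_comm]) (by omega)).symm
  obtain ⟨d, rfl⟩ := Nat.exists_eq_add_of_le hle
  have hprime := Nat.prime_iff_prime_int.1 hp
  have hi5 := not_dvd_five_mul_fib hp hp2 (Int.natCast_dvd_natCast.2 hi)
  have hF : ¬ (p : ℤ) ∣ Nat.fib i := fun h => hi5 (h.mul_left 5)
  obtain ⟨a, ha⟩ := Int.natCast_dvd_natCast.2 hi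
  obtain ⟨b, hb⟩ := Int.natCast_dvd_natCast.2 hj
  obtain ⟨c, hc⟩ := h
  have h1 := two_mul_fib_add i d
  have h2 := two_mul_lucas_add i d
  rw [ha] at h1 h2
  rw [hb] at h2
  have hper : IsFibPeriod p d := by
    constructor
    · refine (hprime.dvd_or_dvd (?_ : (p : ℤ) ∣ 5 * Nat.fib i * Nat.fib d)).resolve_left hi5
      exact ⟨2 * b - a * lucas d, by linarith⟩
    · refine (hprime.dvd_or_dvd (?_ : (p : ℤ) ∣ Nat.fib i * (lucas d - 2))).resolve_left hF
      exact ⟨-2 * c - a * Nat.fib d, by linarith⟩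
  have := Nat.eq_zero_of_dvd_of_lt (pisano_dvd hp hp2 hper) (by omega)
  omega

theorem fib_lucas_mod_pisano (hp : p.Prime) (hp2 : p ≠ 2) (n : ℕ) :
    (Nat.fib n : ZMod (p ^ wallExp p)) = Nat.fib (n % pisano p) ∧
      (p ∣ lucas n ↔ p ∣ lucas (n % pisano p)) := by
  obtain ⟨h1, h2⟩ := fib_lucas_add_pisano_mul hp hp2 (n % pisano p) (n / pisano p)
  rw [Nat.mod_add_div] at h1 h2
  refine ⟨natCast_zmod_pow_eq_iff.2 h1, ?_⟩
  rw [← Int.natCast_dvd_natCast, ← Int.natCast_dvd_natCast]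
  exact dvd_iff_dvd_of_dvd_sub ((dvd_pow_self _ (by have := (wallExp_spec hp hp2).1; omega)).trans h2)

theorem fibFiber_ncard_of_dvd_lucas (hp : p.Prime) (hp2 : p ≠ 2) {i : ℕ}
    (hi : p ∣ lucas i) (hlt : i < pisano p)
    (hne : ∀ j ∈ (Finset.range (pisano p)).filter (fun j => ¬ p ∣ lucas j),
      (Nat.fib i : ZMod (p ^ wallExp p)) ≠ (Nat.fib j : ZMod (p ^ wallExp p))) (k : ℕ) :
    (fibFiber p (wallExp p + k) (Nat.fib i)).ncard = numSquares p k := by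
  have hi' : (p : ℤ) ∣ lucas i := by exact_mod_cast hi
  have he := (wallExp_spec hp hp2).1
  have hpe : (p : ℤ) ∣ (p : ℤ) ^ wallExp p := dvd_pow_self _ (by omega)
  have hL := pow_wallExp_dvd_lucas hp hp2 hi'
  have h5F := not_dvd_five_mul_fib hp hp2 hi'
  have hprime := Nat.prime_iff_prime_int.1 hp
  have h5 : ¬ (p : ℤ) ∣ 5 := fun h => h5F (h.mul_right _)
  have hF : ¬ (p : ℤ) ∣ Nat.fib i := fun h => h5F (h.mul_left _)
  have hset : fibFiber p (wallExp p + k) (Nat.fib i) = Set.range fun t : ℕ =>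
      (Nat.fib (i + pisano p * t) : ZMod (p ^ (wallExp p + (wallExp p + k)))) := by
    ext x
    constructor
    · rintro ⟨⟨n, rfl⟩, hn⟩
      rw [map_natCast] at hn
      obtain ⟨hn1, hn2⟩ := fib_lucas_mod_pisano hp hp2 n
      have hmod : n % pisano p < pisano p := Nat.mod_lt _ (pisano_mem hp hp2).1
      have hz : p ∣ lucas (n % pisano p) := by
        by_contra hz
        exact hne _ (Finset.mem_filter.2 ⟨Finset.mem_range.2 hmod, hz⟩) (hn.symm.trans hn1)
      have heq : i = n % pisano p := lucas_zero_unique hp hp2 hi hz hlt hmod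
        (hpe.trans (natCast_zmod_pow_eq_iff.1 (hn.symm.trans hn1)))
      refine ⟨n / pisano p, ?_⟩
      simp only [heq, Nat.mod_add_div]
    · rintro ⟨t, rfl⟩
      refine ⟨⟨_, rfl⟩, ?_⟩
      rw [map_natCast, natCast_zmod_pow_eq_iff]
      exact (fib_lucas_add_pisano_mul hp hp2 i t).1
  have hsq : (Set.range fun t : ℕ =>
      (((lucas (i + pisano p * t) : ℤ) ^ 2 : ℤ) : ZMod (p ^ (wallExp p + (wallExp p + k))))) =
      Set.range fun s : ℤ =>
        (((p ^ wallExp p * s) ^ 2 : ℤ) : ZMod (p ^ (wallExp p + (wallExp p + k)))) := by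
    ext x
    constructor
    · rintro ⟨t, rfl⟩
      obtain ⟨s, hs⟩ := (dvd_iff_dvd_of_dvd_sub (fib_lucas_add_pisano_mul hp hp2 i t).2).2 hL
      exact ⟨s, by simp only [hs]⟩
    · rintro ⟨s, rfl⟩
      beta_reduce
      have hw : (p : ℤ) ^ wallExp p ∣ p ^ wallExp p * s := dvd_mul_right _ _
      generalize (p : ℤ) ^ wallExp p * s = w at *
      obtain ⟨c, q, hq⟩ : ∃ c : ℤ, (p : ℤ) ^ (wallExp p + (wallExp p + k)) ∣
          w ^ 2 - 4 * (-1) ^ i - 5 * c := by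
        obtain ⟨x, y, hxy⟩ := isCoprime_of_not_dvd hp h5 (wallExp p + (wallExp p + k))
        refine ⟨y * (w ^ 2 - 4 * (-1) ^ i), x * (w ^ 2 - 4 * (-1) ^ i), ?_⟩
        linear_combination -(w ^ 2 - 4 * (-1) ^ i) * hxy
      have hc : (p : ℤ) ^ wallExp p ∣ c - Nat.fib i ^ 2 := by
        refine pow_dvd_of_pow_dvd_mul_left hp h5 ?_
        have h1 := lucas_sq i
        have : 5 * (c - Nat.fib i ^ 2) = w * w - lucas i * lucas i -
            p ^ (wallExp p + (wallExp p + k)) * q := by linear_combination h1 - hq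
        rw [this]
        exact dvd_sub (dvd_sub (hw.mul_right _) (hL.mul_right _))
          ((pow_dvd_pow _ (by omega)).mul_right _)
      obtain ⟨v, hv, b, hb⟩ := exists_sq_lift hp hp2 he hF hc (wallExp p + k)
      obtain ⟨t, _, a, ha⟩ := exists_fib_lucas_of_conic hp hp2 i hv (dvd_sub hw hL)
        (wallExp p + k) ⟨q + 5 * b, by linear_combination hq + 5 * hb⟩
      refine ⟨t, ?_⟩
      rw [intCast_zmod_pow_eq_iff]
      exact ⟨-a * (w + lucas (i + pisano p * t)), by
        linear_combination -(w + lucas (i + pisano p * t)) * ha⟩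
  rw [hset, ← ncard_range_pow_mul_sq hp (wallExp p) k, ← hsq]
  refine Set.ncard_range_eq_of_eq_iff fun s t => ?_
  rw [natCast_zmod_pow_eq_iff, intCast_zmod_pow_eq_iff, lucas_sq, lucas_sq,
    neg_one_pow_add_pisano_mul hp hp2, neg_one_pow_add_pisano_mul hp hp2]
  have hs := hpe.trans (fib_lucas_add_pisano_mul hp hp2 i s).1
  have ht := hpe.trans (fib_lucas_add_pisano_mul hp hp2 i t).1
  generalize (Nat.fib (i + pisano p * s) : ℤ) = x at *
  generalize (Nat.fib (i + pisano p * t) : ℤ) = y at *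
  rw [show 5 * x ^ 2 + 4 * (-1) ^ i - (5 * y ^ 2 + 4 * (-1) ^ i) = 5 * ((x + y) * (x - y)) by ring]
  refine ⟨fun h => (h.mul_left _).mul_left _, fun h => ?_⟩
  refine pow_dvd_of_pow_dvd_mul_left hp ?_ (pow_dvd_of_pow_dvd_mul_left hp h5 h)
  intro hxy
  have h2F : (p : ℤ) ∣ 2 * Nat.fib i := by
    rw [show 2 * (Nat.fib i : ℤ) = x + y - ((x - Nat.fib i) + (y - Nat.fib i)) by ring]
    exact dvd_sub hxy (dvd_add hs ht)
  exact (hprime.dvd_or_dvd h2F).elim (not_dvd_two hp hp2) hF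

theorem card_fib_residues (hp : p.Prime) (hp2 : p ≠ 2) (k : ℕ) :
    Nat.card (Set.range fun n : ℕ => (Nat.fib n : ZMod (p ^ (wallExp p + (wallExp p + k))))) =
      Nres p * p ^ (wallExp p + k) + Zres p * numSquares p k := by
  classical
  have : NeZero (p ^ (wallExp p + (wallExp p + k))) := ⟨pow_ne_zero _ hp.ne_zero⟩
  have he := (wallExp_spec hp hp2).1
  let c := ZMod.castHom (pow_dvd_pow p (Nat.le_add_right (wallExp p) (wallExp p + k)))
    (ZMod (p ^ wallExp p))
  let φ : ℕ → ZMod (p ^ wallExp p) := fun i => Nat.fib i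
  let A := (Finset.range (pisano p)).filter fun i => ¬ p ∣ lucas i
  let B := (Finset.range (pisano p)).filter fun i => p ∣ lucas i ∧ ∀ j ∈ A, φ i ≠ φ j
  let S := Finset.univ.filter fun x : ZMod (p ^ (wallExp p + (wallExp p + k))) =>
    ∃ n : ℕ, (Nat.fib n : ZMod (p ^ (wallExp p + (wallExp p + k)))) = x
  have hS : Nat.card (Set.range fun n : ℕ =>
      (Nat.fib n : ZMod (p ^ (wallExp p + (wallExp p + k))))) = S.card := by
    rw [Nat.card_coe_set_eq, ← Set.ncard_coe_finset]
    congr 1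
    ext x
    simp [S]
  have hfiber (r) : (S.filter fun x => c x = r).card = (fibFiber p (wallExp p + k) r).ncard := by
    rw [← Set.ncard_coe_finset]
    congr 1
    ext x
    rw [Finset.mem_coe, Finset.mem_filter, Finset.mem_filter]
    simp only [Finset.mem_univ, true_and]
    rfl
  have hmaps : (S : Set _).MapsTo c (A.image φ ∪ B.image φ : Finset _) := by
    intro x hx
    obtain ⟨n, rfl⟩ := (Finset.mem_filter.1 hx).2
    have hlt : n % pisano p < pisano p := Nat.mod_lt _ (pisano_mem hp hp2).1
    have hn : c (Nat.fib n) = φ (n % pisano p) := by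
      rw [map_natCast]; exact (fib_lucas_mod_pisano hp hp2 n).1
    rw [hn, Finset.mem_coe, Finset.mem_union]
    by_cases hA : φ (n % pisano p) ∈ A.image φ
    · exact Or.inl hA
    · refine Or.inr (Finset.mem_image_of_mem _ (Finset.mem_filter.2 ⟨Finset.mem_range.2 hlt, ?_, ?_⟩))
      · by_contra hz
        exact hA (Finset.mem_image_of_mem _ (Finset.mem_filter.2 ⟨Finset.mem_range.2 hlt, hz⟩))
      · intro j hj hij
        exact hA (Finset.mem_image.2 ⟨j, hj, hij.symm⟩)
  have hdisj : Disjoint (A.image φ) (B.image φ) := by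
    rw [Finset.disjoint_left]
    intro r hA hB
    obtain ⟨j, hj, rfl⟩ := Finset.mem_image.1 hA
    obtain ⟨i, hi, hij⟩ := Finset.mem_image.1 hB
    exact (Finset.mem_filter.1 hi).2.2 j hj hij
  have hinj : Set.InjOn φ B := by
    intro i hi j hj hij
    obtain ⟨hi1, hi2, _⟩ := Finset.mem_filter.1 hi
    obtain ⟨hj1, hj2, _⟩ := Finset.mem_filter.1 hj
    exact lucas_zero_unique hp hp2 hi2 hj2 (Finset.mem_range.1 hi1) (Finset.mem_range.1 hj1)
      ((dvd_pow_self _ (by omega)).trans (natCast_zmod_pow_eq_iff.1 hij))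
  rw [hS, Finset.card_eq_sum_card_fiberwise hmaps, Finset.sum_union hdisj]
  congr 1
  · refine Finset.sum_eq_card_nsmul fun r hr => ?_
    obtain ⟨j, hj, rfl⟩ := Finset.mem_image.1 hr
    rw [hfiber]
    exact fibFiber_ncard_of_not_dvd_lucas hp hp2 (Finset.mem_filter.1 hj).2 _
  · rw [Finset.sum_image hinj]
    refine Finset.sum_eq_card_nsmul fun i hi => ?_
    rw [hfiber]
    obtain ⟨h1, h2, h3⟩ := Finset.mem_filter.1 hi
    exact fibFiber_ncard_of_dvd_lucas hp hp2 h2 (Finset.mem_range.1 h1) h3 k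

end Fibers

theorem limiting_density_fibonacci_mod_prime_powers (p : ℕ) (hp : p.Prime) (hp2 : p ≠ 2) :
    Filter.Tendsto
      (fun lam : ℕ =>
        (Nat.card (Set.range fun n : ℕ => (Nat.fib n : ZMod (p ^ lam))) : ℝ) / (p : ℝ) ^ lam)
      Filter.atTop
      (nhds ((Nres p : ℝ) / (p : ℝ) ^ wallExp p +
        (Zres p : ℝ) / (2 * (p : ℝ) ^ (2 * wallExp p - 1) * ((p : ℝ) + 1)))) := by
  have he := (wallExp_spec hp hp2).1
  have hp0 : (0 : ℝ) < p := by exact_mod_cast hp.pos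
  rw [← Filter.tendsto_add_atTop_iff_nat (2 * wallExp p)]
  have hcount (k : ℕ) :
      (Nat.card (Set.range fun n : ℕ => (Nat.fib n : ZMod (p ^ (k + 2 * wallExp p)))) : ℝ) /
          (p : ℝ) ^ (k + 2 * wallExp p) =
        Nres p / (p : ℝ) ^ wallExp p +
          Zres p / (p : ℝ) ^ (2 * wallExp p) * (numSquares p k / (p : ℝ) ^ k) := by
    rw [show k + 2 * wallExp p = wallExp p + (wallExp p + k) by ring, card_fib_residues hp hp2]
    push_cast
    field_simp
    ring
  simp only [hcount]
  have hlim : (Zres p : ℝ) / (2 * (p : ℝ) ^ (2 * wallExp p - 1) * ((p : ℝ) + 1)) =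
      Zres p / (p : ℝ) ^ (2 * wallExp p) * (p / (2 * (p + 1))) := by
    obtain ⟨j, hj⟩ : ∃ j, 2 * wallExp p = j + 1 := ⟨2 * wallExp p - 1, by omega⟩
    rw [hj, Nat.add_sub_cancel, pow_succ]
    field_simp
  rw [hlim]
  exact ((tendsto_numSquares_div hp hp2).const_mul _).const_add _
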